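/- Let k ≥ 1, a ∈ Γ_k, and let u be any nontrivial radial Neumann solution of Δu + a u = 0 on B_1. Then u has a zero in the interval [r_1, 1). Moreover, if u(r_1) = 0 and u has no zero in (r_1, 1), then a(r) = μ_k for a.e. r ∈ (r_1, 1). -/

import Mathlib

open MeasureTheory Set Filter

noncomputable section

/-- The measure of the (N-1)-dimensional unit sphere in `ℝ^N`. -/
def omegaN (N : ℕ) : ℝ :=
  N * (volume (Metric.ball (0 : EuclideanSpace ℝ (Fin N)) 1)).toReal

/-- `u` is a radial Neumann solution of `Δu + a u = 0` on the unit ball of `ℝ^N`,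
with explicit derivative function `u'` : `u` is continuous on `[0,1]`, differentiable on
`(0,1]`, satisfies the integrated radial equation
`r^(N-1) u'(r) = -∫_0^r s^(N-1) a(s) u(s) ds` on `(0,1]`, and `u'(1) = 0`. -/
def IsRadialNeumannSolutionDeriv (N : ℕ) (a u u' : ℝ → ℝ) : Prop :=
  ContinuousOn u (Icc 0 1) ∧
  (∀ r ∈ Ioc (0:ℝ) 1, HasDerivAt u (u' r) r) ∧
  (∀ r ∈ Ioc (0:ℝ) 1,
    r ^ (N - 1) * u' r = - ∫ s in (0:ℝ)..r, s ^ (N - 1) * a s * u s) ∧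
  u' 1 = 0

/-- `u` is a radial Neumann solution of `Δu + a u = 0` on the unit ball of `ℝ^N`. -/
def IsRadialNeumannSolution (N : ℕ) (a u : ℝ → ℝ) : Prop :=
  ∃ u' : ℝ → ℝ, IsRadialNeumannSolutionDeriv N a u u'

/-- `u` is not identically zero on `[0,1]`. -/
def NontrivialSol (u : ℝ → ℝ) : Prop := ∃ r ∈ Icc (0:ℝ) 1, u r ≠ 0

/-- `μ ≺ a` : `a(r) ≥ μ` for a.e. `r ∈ (0,1)` and `a(r) > μ` on a set of positive measure. -/
def Prec (μ : ℝ) (a : ℝ → ℝ) : Prop :=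
  (∀ᵐ r ∂(volume.restrict (Ioo (0:ℝ) 1)), μ ≤ a r) ∧
  0 < volume {r ∈ Ioo (0:ℝ) 1 | μ < a r}

/-- A radial function `a` belongs to `L^p(B_1)` (finite `p`). -/
def RadialMemLp (N : ℕ) (p : ℝ) (a : ℝ → ℝ) : Prop :=
  IntegrableOn (fun r => r ^ (N - 1) * |a r| ^ p) (Ioo (0:ℝ) 1)

/-- A radial function `a` belongs to `L^∞(B_1)`. -/
def RadialMemLinfty (a : ℝ → ℝ) : Prop :=
  ∃ C : ℝ, ∀ᵐ r ∂(volume.restrict (Ioo (0:ℝ) 1)), |a r| ≤ C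

/-- The `L^p(B_1)` norm of a radial function (finite `p`):
`(ω_N ∫_0^1 r^(N-1) |a(r)|^p dr)^(1/p)`. -/
def radialLpNorm (N : ℕ) (p : ℝ) (a : ℝ → ℝ) : ℝ :=
  (omegaN N * ∫ r in (0:ℝ)..1, r ^ (N - 1) * |a r| ^ p) ^ (1 / p)

/-- The `L^∞(B_1)` norm of a radial function: essential supremum of `|a|` on `(0,1)`. -/
def radialLinftyNorm (a : ℝ → ℝ) : ℝ :=
  essSup (fun r => |a r|) (volume.restrict (Ioo (0:ℝ) 1))

/-- The admissible class `Γ_k` at level `μk`: radial measurable `a` with `μk ≺ a`, such that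
`Δu + a u = 0` has a nontrivial radial Neumann solution, and `a ∈ L^{N/2}(B_1)` if `N ≥ 3`,
or `a ∈ L^q(B_1)` for some `q ∈ (1,∞]` if `N = 2`. -/
def GammaSet (N : ℕ) (μk : ℝ) (a : ℝ → ℝ) : Prop :=
  Measurable a ∧ Prec μk a ∧
  (∃ u : ℝ → ℝ, IsRadialNeumannSolution N a u ∧ NontrivialSol u) ∧
  (if 3 ≤ N then RadialMemLp N ((N : ℝ) / 2) a
   else (∃ q : ℝ, 1 < q ∧ RadialMemLp N q a) ∨ RadialMemLinfty a)

/-- The Lyapunov constant `γ_{p,k}` for finite `p`. -/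
def gammaLyap (N : ℕ) (μk : ℝ) (p : ℝ) : ℝ :=
  sInf {t : ℝ | ∃ a : ℝ → ℝ, GammaSet N μk a ∧ RadialMemLp N p a ∧
    t = radialLpNorm N p (fun r => a r - μk)}

/-- The Lyapunov constant `γ_{∞,k}`. -/
def gammaLyapInfty (N : ℕ) (μk : ℝ) : ℝ :=
  sInf {t : ℝ | ∃ a : ℝ → ℝ, GammaSet N μk a ∧ RadialMemLinfty a ∧
    t = radialLinftyNorm (fun r => a r - μk)}

/-- `(μ, φ)` is the `k`-th radial Neumann eigenpair of `-Δ` on `B_1 ⊆ ℝ^N`: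
`μ ≥ 0`, `φ` is a nontrivial radial Neumann solution of `Δφ + μ φ = 0` having exactly `k`
zeros in `(0,1)`, all simple, given by `rz k < rz (k-1) < ⋯ < rz 1`. -/
def IsRadialNeumannEigenpair (N k : ℕ) (μ : ℝ) (φ : ℝ → ℝ) (rz : ℕ → ℝ) : Prop :=
  0 ≤ μ ∧
  IsRadialNeumannSolution N (fun _ => μ) φ ∧ NontrivialSol φ ∧
  (∀ i, 1 ≤ i → i ≤ k → rz i ∈ Ioo (0:ℝ) 1) ∧
  (∀ i j, 1 ≤ i → i < j → j ≤ k → rz j < rz i) ∧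
  (∀ x ∈ Ioo (0:ℝ) 1, (φ x = 0 ↔ ∃ i, 1 ≤ i ∧ i ≤ k ∧ x = rz i)) ∧
  (∀ i, 1 ≤ i → i ≤ k → ∃ d : ℝ, d ≠ 0 ∧ HasDerivAt φ d (rz i))

/-- `u` (with derivative `u'`) is a radial `H^1` solution of `Δu + a u = 0` in `B_1`:
continuous on `(0,1]`, differentiable on `(0,1)`, satisfying the integrated radial equation
between any two radii, with finite radial `H^1` energy. -/
def IsRadialH1Solution (N : ℕ) (a u u' : ℝ → ℝ) : Prop :=
  ContinuousOn u (Ioc 0 1) ∧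
  (∀ r ∈ Ioo (0:ℝ) 1, HasDerivAt u (u' r) r) ∧
  (∀ s ∈ Ioo (0:ℝ) 1, ∀ r ∈ Ioo (0:ℝ) 1, s < r →
    r ^ (N - 1) * u' r - s ^ (N - 1) * u' s
      = - ∫ t in s..r, t ^ (N - 1) * a t * u t) ∧
  IntegrableOn (fun r => r ^ (N - 1) * ((u' r) ^ 2 + (u r) ^ 2)) (Ioo (0:ℝ) 1)

/-- The Sobolev quotient: infimum of `(∫_{B_ρ} |∇w|²) / (∫_{B_ρ} |w|^q)^{2/q}` over nontrivial
`C^1` functions `w : ℝ^N → ℝ` with compact support contained in the ball `B_ρ`. -/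
def sobolevQuot (N : ℕ) (q : ℝ) (ρ : ℝ) : ℝ :=
  sInf {t : ℝ | ∃ w : EuclideanSpace ℝ (Fin N) → ℝ,
    ContDiff ℝ 1 w ∧ (∃ x, w x ≠ 0) ∧ tsupport w ⊆ Metric.ball 0 ρ ∧
    t = (∫ x in Metric.ball (0 : EuclideanSpace ℝ (Fin N)) ρ, ‖fderiv ℝ w x‖ ^ 2) /
        (∫ x in Metric.ball (0 : EuclideanSpace ℝ (Fin N)) ρ, |w x| ^ q) ^ (2 / q)}

theorem exists_mul_pos_of_ne_zero {f : ℝ → ℝ} {a b : ℝ} (hf : ContinuousOn f (Ioo a b))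
    (hne : ∀ x ∈ Ioo a b, f x ≠ 0) : ∃ σ : ℝ, σ ≠ 0 ∧ ∀ x ∈ Ioo a b, 0 < σ * f x := by
  by_cases h : ∀ x ∈ Ioo a b, 0 < f x
  · exact ⟨1, one_ne_zero, by simpa using h⟩
  · push Not at h
    obtain ⟨x, hx, hfx⟩ := h
    refine ⟨-1, by norm_num, fun y hy => ?_⟩
    by_contra! hfy
    obtain ⟨z, hz, hfz⟩ := isPreconnected_Ioo.intermediate_value hx hy hf
      (show (0 : ℝ) ∈ Icc (f x) (f y) from ⟨hfx, by linarith⟩)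
    exact hne z hz hfz

theorem RadialMemLp.intervalIntegrable {N : ℕ} {p : ℝ} {a : ℝ → ℝ} (hp : 1 ≤ p)
    (ha : Measurable a) (h : RadialMemLp N p a) :
    IntervalIntegrable (fun r => r ^ (N - 1) * a r) volume 0 1 := by
  rw [intervalIntegrable_iff_integrableOn_Ioo_of_le zero_le_one]
  have h1 : IntegrableOn (fun r : ℝ => r ^ (N - 1)) (Ioo 0 1) :=
    ((continuous_pow _).integrableOn_Icc (a := 0) (b := 1)).mono_set Ioo_subset_Icc_self
  refine (h1.add h).mono' (by fun_prop) ?_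
  filter_upwards [ae_restrict_mem measurableSet_Ioo] with r hr
  have hw : 0 ≤ r ^ (N - 1) := pow_nonneg hr.1.le _
  have hle : |a r| ≤ 1 + |a r| ^ p := by
    rcases le_total (|a r|) 1 with h' | h'
    · have := Real.rpow_nonneg (abs_nonneg (a r)) p
      linarith
    · have := Real.self_le_rpow_of_one_le h' hp
      linarith
  calc ‖r ^ (N - 1) * a r‖ = r ^ (N - 1) * |a r| := by
        rw [norm_mul, Real.norm_eq_abs, Real.norm_eq_abs, abs_of_nonneg hw]
    _ ≤ r ^ (N - 1) * (1 + |a r| ^ p) := mul_le_mul_of_nonneg_left hle hw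
    _ = _ := by simp [mul_add]

theorem RadialMemLinfty.intervalIntegrable {N : ℕ} {a : ℝ → ℝ} (ha : Measurable a)
    (h : RadialMemLinfty a) :
    IntervalIntegrable (fun r => r ^ (N - 1) * a r) volume 0 1 := by
  rw [intervalIntegrable_iff_integrableOn_Ioo_of_le zero_le_one]
  obtain ⟨C, hC⟩ := h
  have h1 : IntegrableOn (fun _ : ℝ => C) (Ioo (0 : ℝ) 1) := integrableOn_const (by simp)
  refine h1.mono' (by fun_prop) ?_
  filter_upwards [ae_restrict_mem measurableSet_Ioo, hC] with r hr hr'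
  have hw : 0 ≤ r ^ (N - 1) := pow_nonneg hr.1.le _
  have hw1 : r ^ (N - 1) ≤ 1 := pow_le_one₀ hr.1.le hr.2.le
  rw [norm_mul, Real.norm_eq_abs, Real.norm_eq_abs, abs_of_nonneg hw]
  exact (mul_le_of_le_one_left (abs_nonneg _) hw1).trans hr'

theorem GammaSet.intervalIntegrable {N : ℕ} {μ : ℝ} {a : ℝ → ℝ} (h : GammaSet N μ a) :
    IntervalIntegrable (fun r => r ^ (N - 1) * a r) volume 0 1 := by
  obtain ⟨ha, -, -, h⟩ := h
  split_ifs at h with hN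
  · have hN' : (3 : ℝ) ≤ N := by exact_mod_cast hN
    exact h.intervalIntegrable (by linarith) ha
  · rcases h with ⟨q, hq, h⟩ | h
    · exact h.intervalIntegrable hq.le ha
    · exact h.intervalIntegrable ha

namespace IsRadialNeumannSolutionDeriv

variable {N : ℕ} {a b u u' v v' : ℝ → ℝ} {c : ℝ}

theorem intervalIntegrable (h : IsRadialNeumannSolutionDeriv N a u u')
    (ha : IntervalIntegrable (fun r => r ^ (N - 1) * a r) volume 0 1) :
    IntervalIntegrable (fun r => r ^ (N - 1) * a r * u r) volume 0 1 :=
  ha.mul_continuousOn (by rw [uIcc_of_le zero_le_one]; exact h.1)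

theorem intervalIntegrable_right (h : IsRadialNeumannSolutionDeriv N a u u')
    (ha : IntervalIntegrable (fun r => r ^ (N - 1) * a r) volume 0 1) (hc : c ∈ Ioc (0 : ℝ) 1) :
    IntervalIntegrable (fun r => r ^ (N - 1) * a r * u r) volume c 1 := by
  refine (h.intervalIntegrable ha).mono_set ?_
  rw [uIcc_of_le hc.2, uIcc_of_le zero_le_one]
  exact Icc_subset_Icc_left hc.1.le

/-- The flux `r ^ (N - 1) * u' r` expressed as an integral up to the boundary. -/
theorem flux_eq (h : IsRadialNeumannSolutionDeriv N a u u')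
    (ha : IntervalIntegrable (fun r => r ^ (N - 1) * a r) volume 0 1) (hc : c ∈ Ioc (0 : ℝ) 1) :
    c ^ (N - 1) * u' c = ∫ s in c..1, s ^ (N - 1) * a s * u s := by
  have hi := h.intervalIntegrable ha
  have h1 := h.2.2.1 1 ⟨one_pos, le_rfl⟩
  rw [h.2.2.2, mul_zero] at h1
  have h2 := intervalIntegral.integral_interval_sub_left hi
    (hi.mono_set (c := 0) (d := c) (by
      rw [uIcc_of_le hc.1.le, uIcc_of_le zero_le_one]; exact Icc_subset_Icc_right hc.2))
  rw [h.2.2.1 c hc]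
  linarith

theorem absolutelyContinuous_integral (h : IsRadialNeumannSolutionDeriv N a u u')
    (ha : IntervalIntegrable (fun r => r ^ (N - 1) * a r) volume 0 1) (hc : c ∈ Ioc (0 : ℝ) 1) :
    AbsolutelyContinuousOnInterval
      (fun x => ∫ s in (1 : ℝ)..x, s ^ (N - 1) * a s * u s) c 1 :=
  (h.intervalIntegrable_right ha hc).absolutelyContinuousOnInterval_intervalIntegral
    right_mem_uIcc

theorem flux_eq_neg (h : IsRadialNeumannSolutionDeriv N a u u')
    (ha : IntervalIntegrable (fun r => r ^ (N - 1) * a r) volume 0 1) (hc : c ∈ Ioc (0 : ℝ) 1) :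
    ∫ s in (1 : ℝ)..c, s ^ (N - 1) * a s * u s = -(c ^ (N - 1) * u' c) := by
  rw [intervalIntegral.integral_symm, h.flux_eq ha hc]

theorem absolutelyContinuous (h : IsRadialNeumannSolutionDeriv N a u u')
    (ha : IntervalIntegrable (fun r => r ^ (N - 1) * a r) volume 0 1) (hc : c ∈ Ioc (0 : ℝ) 1) :
    AbsolutelyContinuousOnInterval u c 1 := by
  have hsub : ∀ x ∈ Icc c 1, x ∈ Ioc (0 : ℝ) 1 := fun x hx => ⟨hc.1.trans_le hx.1, hx.2⟩
  have hcont : ContinuousOn u' (Icc c 1) := by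
    have h1 := (h.absolutelyContinuous_integral ha hc).continuousOn
    rw [uIcc_of_le hc.2] at h1
    have h2 : ContinuousOn (fun x : ℝ => x ^ (N - 1)) (Icc c 1) := by fun_prop
    refine (h1.neg.div h2 fun x hx => (pow_pos (hsub x hx).1 _).ne').congr fun x hx => ?_
    have hpos := (pow_pos (hsub x hx).1 (N - 1)).ne'
    simp only [Pi.neg_apply, Pi.div_apply]
    rw [h.flux_eq_neg ha (hsub x hx)]
    field_simp
  obtain ⟨C, hC⟩ := isCompact_Icc.exists_bound_of_continuousOn hcont
  refine LipschitzOnWith.absolutelyContinuousOnInterval (K := C.toNNReal) ?_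
  rw [uIcc_of_le hc.2]
  exact (convex_Icc c 1).lipschitzOnWith_of_nnnorm_hasDerivWithin_le
    (fun x hx => (h.2.1 x (hsub x hx)).hasDerivWithinAt)
    (fun x hx => by
      rw [← NNReal.coe_le_coe, coe_nnnorm]
      exact (hC x hx).trans (Real.le_coe_toNNReal C))

/-- Lagrange's identity for two radial Neumann solutions on `[c, 1]`. -/
theorem lagrange_identity (hu : IsRadialNeumannSolutionDeriv N a u u')
    (hv : IsRadialNeumannSolutionDeriv N b v v')
    (ha : IntervalIntegrable (fun r => r ^ (N - 1) * a r) volume 0 1)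
    (hb : IntervalIntegrable (fun r => r ^ (N - 1) * b r) volume 0 1) (hc : c ∈ Ioc (0 : ℝ) 1) :
    ∫ s in c..1, s ^ (N - 1) * (a s - b s) * (u s * v s) =
      c ^ (N - 1) * u' c * v c - c ^ (N - 1) * v' c * u c := by
  have hac := ((hu.absolutelyContinuous_integral ha hc).fun_mul
    (hv.absolutelyContinuous hb hc)).fun_sub
    ((hv.absolutelyContinuous_integral hb hc).fun_mul (hu.absolutelyContinuous ha hc))
  have hint := hac.integral_deriv_eq_sub
  simp only [hu.flux_eq_neg ha hc, hv.flux_eq_neg hb hc, intervalIntegral.integral_same] at hint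
  have hcongr : ∫ s in c..1, s ^ (N - 1) * (a s - b s) * (u s * v s) =
      ∫ x in c..1, deriv (fun x => (∫ s in (1 : ℝ)..x, s ^ (N - 1) * a s * u s) * v x -
        (∫ s in (1 : ℝ)..x, s ^ (N - 1) * b s * v s) * u x) x := by
    apply intervalIntegral.integral_congr_ae
    filter_upwards [(hu.intervalIntegrable_right ha hc).ae_hasDerivAt_integral,
      (hv.intervalIntegrable_right hb hc).ae_hasDerivAt_integral] with x hxu hxv hx
    have hx' : x ∈ uIcc c 1 := uIoc_subset_uIcc hx
    have hx1 : x ∈ Ioc (0 : ℝ) 1 := by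
      rw [uIcc_of_le hc.2] at hx'
      exact ⟨hc.1.trans_le hx'.1, hx'.2⟩
    have hd := ((hxu hx' 1 right_mem_uIcc).fun_mul (hv.2.1 x hx1)).fun_sub
      ((hxv hx' 1 right_mem_uIcc).fun_mul (hu.2.1 x hx1))
    rw [hd.deriv, hu.flux_eq_neg ha hx1, hv.flux_eq_neg hb hx1]
    ring
  rw [hcongr, hint]
  ring

/-- Comparison on the last nodal interval `(c, 1)` of `v`. -/
theorem flux_mul_eq_zero_and_ae_eq {μ : ℝ} (hu : IsRadialNeumannSolutionDeriv N a u u')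
    (hv : IsRadialNeumannSolutionDeriv N (fun _ => μ) v v')
    (ha : IntervalIntegrable (fun r => r ^ (N - 1) * a r) volume 0 1) (hμ : 0 ≤ μ)
    (hle : ∀ᵐ r ∂(volume.restrict (Ioo (0:ℝ) 1)), μ ≤ a r)
    (hc : c ∈ Ioo (0 : ℝ) 1) (hvc : v c = 0) (hv0 : ∀ x ∈ Ioo c 1, v x ≠ 0)
    (hu0 : ∀ x ∈ Ioo c 1, u x ≠ 0) :
    v' c * u c = 0 ∧ ∀ᵐ r ∂(volume.restrict (Ioo c 1)), a r = μ := by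
  have hc' : c ∈ Ioc (0 : ℝ) 1 := ⟨hc.1, hc.2.le⟩
  have hb : IntervalIntegrable (fun r : ℝ => r ^ (N - 1) * μ) volume 0 1 :=
    (by fun_prop : Continuous fun r : ℝ => r ^ (N - 1) * μ).intervalIntegrable _ _
  have hsub : Icc c 1 ⊆ Icc 0 1 := Icc_subset_Icc_left hc.1.le
  obtain ⟨σ, hσ, hσv⟩ := exists_mul_pos_of_ne_zero
    (hv.1.mono (Ioo_subset_Icc_self.trans hsub)) hv0
  obtain ⟨τ, hτ, hτu⟩ := exists_mul_pos_of_ne_zero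
    (hu.1.mono (Ioo_subset_Icc_self.trans hsub)) hu0
  have huc : 0 ≤ τ * u c := by
    have hcl : c ∈ closure (Ioo c 1) := by
      rw [closure_Ioo hc.2.ne]; exact left_mem_Icc.2 hc.2.le
    exact ContinuousWithinAt.closure_le hcl continuousWithinAt_const
      ((hu.2.1 c hc').continuousAt.continuousWithinAt.const_mul τ)
      (fun y hy => (hτu y hy).le)
  have hfl : 0 ≤ σ * (c ^ (N - 1) * v' c) := by
    rw [hv.flux_eq hb hc', ← intervalIntegral.integral_const_mul,
      intervalIntegral.integral_of_le hc.2.le, integral_Ioc_eq_integral_Ioo]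
    refine setIntegral_nonneg measurableSet_Ioo fun x hx => ?_
    have := mul_nonneg (mul_nonneg (pow_nonneg (hc.1.trans hx.1).le (N - 1)) hμ) (hσv x hx).le
    linarith
  have hlag := hu.lagrange_identity hv ha hb hc'
  rw [hvc, mul_zero, zero_sub] at hlag
  set F : ℝ → ℝ := fun s => s ^ (N - 1) * (a s - μ) * ((τ * u s) * (σ * v s)) with hF
  have hFint : ∫ s in Ioo c 1, F s = -((σ * (c ^ (N - 1) * v' c)) * (τ * u c)) := by
    rw [← integral_Ioc_eq_integral_Ioo, ← intervalIntegral.integral_of_le hc.2.le]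
    calc ∫ s in c..1, F s = ∫ s in c..1, (σ * τ) * (s ^ (N - 1) * (a s - μ) * (u s * v s)) := by
          congr 1; ext s; simp only [hF]; ring
      _ = _ := by rw [intervalIntegral.integral_const_mul, hlag]; ring
  have hFnn : 0 ≤ᵐ[volume.restrict (Ioo c 1)] F := by
    filter_upwards [ae_restrict_mem measurableSet_Ioo,
      ae_restrict_of_ae_restrict_of_subset (Ioo_subset_Ioo_left hc.1.le) hle] with x hx hx'
    exact mul_nonneg (mul_nonneg (pow_nonneg (hc.1.trans hx.1).le _) (sub_nonneg.2 hx'))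
      (mul_pos (hτu x hx) (hσv x hx)).le
  have hFI : IntegrableOn F (Ioo c 1) := by
    rw [← intervalIntegrable_iff_integrableOn_Ioo_of_le hc.2.le]
    have hsub' : uIcc c 1 ⊆ uIcc 0 1 := by
      rwa [uIcc_of_le hc.2.le, uIcc_of_le zero_le_one]
    have hcu := hu.1.mono hsub
    have hcv := hv.1.mono hsub
    refine (((ha.sub hb).mono_set hsub').mul_continuousOn
      (g := fun s => (τ * u s) * (σ * v s)) ?_).congr ?_
    · rw [uIcc_of_le hc.2.le]; fun_prop
    · exact fun s _ => by simp only [hF]; ring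
  have hprod := mul_nonneg hfl huc
  have hnn : 0 ≤ ∫ s in Ioo c 1, F s := integral_nonneg_of_ae hFnn
  have hzero : σ * (c ^ (N - 1) * v' c) * (τ * u c) = 0 := by linarith
  refine ⟨?_, ?_⟩
  · have hcp := (pow_pos hc.1 (N - 1)).ne'
    have : (σ * c ^ (N - 1) * τ) * (v' c * u c) = 0 := by linarith
    exact (mul_eq_zero.1 this).resolve_left (mul_ne_zero (mul_ne_zero hσ hcp) hτ)
  · have h0 : ∫ s in Ioo c 1, F s = 0 := by rw [hFint, hzero, neg_zero]
    filter_upwards [(integral_eq_zero_iff_of_nonneg_ae hFnn hFI).1 h0,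
      ae_restrict_mem measurableSet_Ioo] with x hx0 hx
    have h1 := (pow_pos (hc.1.trans hx.1) (N - 1)).ne'
    have h2 := (mul_pos (hτu x hx) (hσv x hx)).ne'
    exact sub_eq_zero.1 ((mul_eq_zero.1 ((mul_eq_zero.1 hx0).resolve_right h2)).resolve_left h1)

end IsRadialNeumannSolutionDeriv

/-- For `k ≥ 1`, `a ∈ Γ_k`, any nontrivial radial Neumann solution `u` of
`Δu + a u = 0` vanishes in `[r_1, 1)`; moreover if `u(r_1) = 0` is its only zero there,
then `a ≡ μ_k` a.e. on `(r_1, 1)`. -/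
theorem stmt7 (N k : ℕ) (hN : 2 ≤ N) (hk1 : 1 ≤ k) (μk : ℝ) (φk : ℝ → ℝ) (rz : ℕ → ℝ)
    (hek : IsRadialNeumannEigenpair N k μk φk rz)
    (a : ℝ → ℝ) (ha : GammaSet N μk a)
    (u : ℝ → ℝ) (hu : IsRadialNeumannSolution N a u) (hunt : NontrivialSol u) :
    (∃ z ∈ Ico (rz 1) 1, u z = 0) ∧
    (u (rz 1) = 0 → (∀ z ∈ Ioo (rz 1) 1, u z ≠ 0) →
      ∀ᵐ r ∂(volume.restrict (Ioo (rz 1) 1)), a r = μk) := by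
  obtain ⟨hμ, ⟨φ', hφ⟩, -, hr, hord, hzero, hsimple⟩ := hek
  obtain ⟨u', hu⟩ := hu
  have hc := hr 1 le_rfl hk1
  have hφc : φk (rz 1) = 0 := (hzero _ hc).2 ⟨1, le_rfl, hk1, rfl⟩
  have hφ0 : ∀ x ∈ Ioo (rz 1) 1, φk x ≠ 0 := by
    intro x hx h0
    obtain ⟨i, hi1, hik, rfl⟩ := (hzero x ⟨hc.1.trans hx.1, hx.2⟩).1 h0
    rcases hi1.eq_or_lt with rfl | hlt
    · exact lt_irrefl _ hx.1
    · exact lt_asymm hx.1 (hord 1 i le_rfl hlt hik)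
  have key := fun hu0 => hu.flux_mul_eq_zero_and_ae_eq hφ ha.intervalIntegrable hμ ha.2.1.1
    hc hφc hφ0 hu0
  refine ⟨?_, fun _ hu0 => (key hu0).2⟩
  by_contra! hne
  obtain ⟨d, hd, hder⟩ := hsimple 1 le_rfl hk1
  have hφ' : φ' (rz 1) ≠ 0 := by
    rwa [(hφ.2.1 _ ⟨hc.1, hc.2.le⟩).unique hder]
  exact mul_ne_zero hφ' (hne _ ⟨le_rfl, hc.2⟩) (key fun x hx => hne x ⟨hx.1.le, hx.2⟩).1
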